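/- Let n ∈ ℕ with n ≥ 3. The system of sets of lengths 𝓛(B_n) of B_n = ⟨a, b | ba = b^n⟩ is closed under set addition: for all L_1, L_2 ∈ 𝓛(B_n) one has L_1 + L_2 ∈ 𝓛(B_n). Consequently, 𝓛(B_n) with set addition as operation is a reduced atomic unit-cancellative commutative monoid with zero element {0}. -/

import Mathlib

/-- An atom (irreducible element) of a monoid: a non-unit `u` such that
`u = b * c` implies that `b` or `c` is a unit. -/
def IsMonAtom {M : Type*} [Monoid M] (u : M) : Prop :=
  ¬ IsUnit u ∧ ∀ b c : M, u = b * c → IsUnit b ∨ IsUnit c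

/-- A monoid is reduced if its only invertible element is `1`. -/
def MonReduced (M : Type*) [Monoid M] : Prop := ∀ u : M, IsUnit u → u = 1

/-- A monoid is (left and right) unit-cancellative if `a = a * u` or `a = u * a`
implies that `u` is a unit. -/
def UnitCancellative (M : Type*) [Monoid M] : Prop :=
  (∀ a u : M, a * u = a → IsUnit u) ∧ (∀ a u : M, u * a = a → IsUnit u)

/-- A monoid is atomic if every non-unit is a finite product of atoms. -/
def MonAtomic (M : Type*) [Monoid M] : Prop :=
  ∀ a : M, ¬ IsUnit a → ∃ l : List M, (∀ u ∈ l, IsMonAtom u) ∧ l.prod = a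

attribute [local instance] Classical.propDecidable

/-- The set of lengths `L(a)` of an element: the set of all `k ∈ ℕ` such that `a`
is a product of `k` atoms, with the convention `L(1) = {0}`. -/
noncomputable def setOfLengths {M : Type*} [Monoid M] (x : M) : Set ℕ :=
  if x = 1 then {0}
  else {k | ∃ l : List M, l.length = k ∧ (∀ u ∈ l, IsMonAtom u) ∧ l.prod = x}

/-- The system of sets of lengths `𝓛(M) = {L(a) : a ∈ M}`. -/
def LSystem (M : Type*) [Monoid M] : Set (Set ℕ) :=
  Set.range (setOfLengths (M := M))

/-- `U_k(M)`, the union of all sets of lengths containing `k`. -/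
def unionOfLengths (M : Type*) [Monoid M] (k : ℕ) : Set ℕ :=
  ⋃₀ {L | L ∈ LSystem M ∧ k ∈ L}
/-- The defining relation `b * a = b ^ n` of the monoid `B_n`, on the free
monoid over two generators (`0` stands for `a`, `1` stands for `b`). -/
def BnRel (n : ℕ) : FreeMonoid (Fin 2) → FreeMonoid (Fin 2) → Prop := fun x y =>
  x = FreeMonoid.of 1 * FreeMonoid.of 0 ∧ y = FreeMonoid.of 1 ^ n

/-- The congruence on the free monoid generated by the relation `b * a = b ^ n`. -/
def BnCon (n : ℕ) : Con (FreeMonoid (Fin 2)) := conGen (BnRel n)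

/-- The monoid `B_n = ⟨ a, b ∣ b * a = b ^ n ⟩`. -/
abbrev Bn (n : ℕ) := (BnCon n).Quotient

/-- The generator `a` of `B_n`. -/
def bA (n : ℕ) : Bn n := (BnCon n).mk' (FreeMonoid.of 0)

/-- The generator `b` of `B_n`. -/
def bB (n : ℕ) : Bn n := (BnCon n).mk' (FreeMonoid.of 1)

open scoped Pointwise

/-- An atom of the monoid `(𝓛(B_n), +)` of sets of lengths under set addition:
a nonzero element which cannot be written as a sum of two nonzero elements.
(Here `0 = {0}` is the zero element of pointwise set addition.) -/
def LSysAtom (n : ℕ) (X : Set ℕ) : Prop :=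
  X ∈ LSystem (Bn n) ∧ X ≠ 0 ∧
    ∀ Y Z : Set ℕ, Y ∈ LSystem (Bn n) → Z ∈ LSystem (Bn n) → X = Y + Z →
      Y = 0 ∨ Z = 0

/-- One step of the right action of the generators of `B_{d+2}` on the exponents `(i, j)` of the
normal forms `a ^ i * b ^ j`. -/
def normalStep (d : ℕ) (s : ℕ × ℕ) (x : Fin 2) : ℕ × ℕ :=
  if x = 1 then (s.1, s.2 + 1) else if s.2 = 0 then (s.1 + 1, 0) else (s.1, s.2 + (d + 1))

/-- The right action of words on the exponents of normal forms. -/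
def normalFrom (d : ℕ) (s : ℕ × ℕ) (w : FreeMonoid (Fin 2)) : ℕ × ℕ :=
  w.toList.foldl (normalStep d) s

theorem length_freeMonoid_of_pow (x : Fin 2) (m : ℕ) : (FreeMonoid.of x ^ m).length = m := by
  induction m with
  | zero => rfl
  | succ m ih => rw [pow_succ, FreeMonoid.length_mul, ih, FreeMonoid.length_of]

theorem normalFrom_one (d : ℕ) (s : ℕ × ℕ) : normalFrom d s 1 = s := rfl

theorem normalFrom_mul (d : ℕ) (s : ℕ × ℕ) (v w : FreeMonoid (Fin 2)) :
    normalFrom d s (v * w) = normalFrom d (normalFrom d s v) w := by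
  simp [normalFrom, FreeMonoid.toList_mul]

theorem normalFrom_of (d : ℕ) (s : ℕ × ℕ) (x : Fin 2) :
    normalFrom d s (FreeMonoid.of x) = normalStep d s x := by
  simp [normalFrom]

theorem normalFrom_b_pow (d i j m : ℕ) :
    normalFrom d (i, j) (FreeMonoid.of 1 ^ m) = (i, j + m) := by
  induction m with
  | zero => rfl
  | succ m ih => rw [pow_succ, normalFrom_mul, ih, normalFrom_of]; simp [normalStep]; omega

theorem normalFrom_a_pow (d i m : ℕ) :
    normalFrom d (i, 0) (FreeMonoid.of 0 ^ m) = (i + m, 0) := by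
  induction m with
  | zero => rfl
  | succ m ih => rw [pow_succ, normalFrom_mul, ih, normalFrom_of]; simp [normalStep]; omega

theorem normalFrom_a_pow_succ (d i j m : ℕ) :
    normalFrom d (i, j + 1) (FreeMonoid.of 0 ^ m) = (i, j + 1 + (d + 1) * m) := by
  induction m with
  | zero => rfl
  | succ m ih => rw [pow_succ, normalFrom_mul, ih, normalFrom_of]; simp [normalStep]; ring

/-- The congruence of acting identically on exponents of normal forms. -/
def normalCon (d : ℕ) : Con (FreeMonoid (Fin 2)) where
  r v w := ∀ s, normalFrom d s v = normalFrom d s w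
  iseqv := ⟨fun _ _ => rfl, fun h s => (h s).symm, fun h h' s => (h s).trans (h' s)⟩
  mul' h h' s := by rw [normalFrom_mul, normalFrom_mul, h, h']

theorem bnCon_le_normalCon (d : ℕ) : BnCon (d + 2) ≤ normalCon d := by
  refine Con.conGen_le.2 ?_
  rintro v w ⟨rfl, rfl⟩ ⟨i, j⟩
  rw [normalFrom_mul, normalFrom_of, normalFrom_of, normalFrom_b_pow]
  simp [normalStep]
  omega

/-- The canonical projection from words to `B_n`. -/
abbrev bnMk (n : ℕ) : FreeMonoid (Fin 2) →* Bn n := (BnCon n).mk'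

theorem bnMk_surjective (n : ℕ) : Function.Surjective (bnMk n) := Con.mk'_surjective

theorem normalFrom_eq_of_bnMk_eq {d : ℕ} {v w : FreeMonoid (Fin 2)}
    (h : bnMk (d + 2) v = bnMk (d + 2) w) (s : ℕ × ℕ) : normalFrom d s v = normalFrom d s w :=
  bnCon_le_normalCon d ((BnCon (d + 2)).eq.1 h) s

theorem bB_mul_bA (n : ℕ) : bB n * bA n = bB n ^ n := by
  have h : bnMk n (FreeMonoid.of 1 * FreeMonoid.of 0) = bnMk n (FreeMonoid.of 1 ^ n) :=
    (BnCon n).eq.2 (ConGen.Rel.of _ _ ⟨rfl, rfl⟩)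
  rwa [map_mul, map_pow] at h

/-- Right induction on words. -/
theorem freeMonoid_induction_right {p : FreeMonoid (Fin 2) → Prop} (one : p 1)
    (a : ∀ w, p w → p (w * FreeMonoid.of 0)) (b : ∀ w, p w → p (w * FreeMonoid.of 1))
    (w : FreeMonoid (Fin 2)) : p w := by
  refine List.reverseRecOn (motive := p) w one fun l x h => ?_
  fin_cases x
  · exact a l h
  · exact b l h

theorem bnMk_eq_pow_mul_pow (d : ℕ) (w : FreeMonoid (Fin 2)) :
    bnMk (d + 2) w = bA (d + 2) ^ (normalFrom d (0, 0) w).1 *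
      bB (d + 2) ^ (normalFrom d (0, 0) w).2 := by
  induction w using freeMonoid_induction_right with
  | one => simp [normalFrom_one]
  | b w ih =>
    rw [map_mul, ih, normalFrom_mul, normalFrom_of]
    simp only [normalStep, if_true, pow_succ, mul_assoc]
    rfl
  | a w ih =>
    rw [map_mul, ih, normalFrom_mul, normalFrom_of]
    change _ * bA (d + 2) = _
    rcases normalFrom d (0, 0) w with ⟨i, _ | j⟩
    · simp [normalStep, pow_succ]
    · simp only [normalStep]
      rw [pow_succ, mul_assoc, mul_assoc, bB_mul_bA, ← pow_add]
      simp
      congr 2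
      omega

theorem bnMk_eq_iff {d : ℕ} {v w : FreeMonoid (Fin 2)} :
    bnMk (d + 2) v = bnMk (d + 2) w ↔ normalFrom d (0, 0) v = normalFrom d (0, 0) w :=
  ⟨fun h => normalFrom_eq_of_bnMk_eq h _, fun h => by
    rw [bnMk_eq_pow_mul_pow, bnMk_eq_pow_mul_pow, h]⟩

/-- The lengths of the words with a given normal form. -/
theorem exists_length_normalFrom (d : ℕ) (w : FreeMonoid (Fin 2)) :
    ((normalFrom d (0, 0) w).2 = 0 ∧ (normalFrom d (0, 0) w).1 = w.length) ∨
      ∃ t, t * (d + 1) + 1 ≤ (normalFrom d (0, 0) w).2 ∧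
        w.length + d * t = (normalFrom d (0, 0) w).1 + (normalFrom d (0, 0) w).2 := by
  induction w using freeMonoid_induction_right with
  | one => exact Or.inl ⟨rfl, rfl⟩
  | b w ih =>
    rw [normalFrom_mul, normalFrom_of, FreeMonoid.length_mul, FreeMonoid.length_of]
    generalize normalFrom d (0, 0) w = s at ih ⊢
    obtain ⟨i, j⟩ := s
    simp only at ih
    right
    simp only [normalStep, if_true]
    rcases ih with ⟨rfl, h⟩ | ⟨t, h, h'⟩
    · exact ⟨0, by simp, by simp [h]⟩
    · exact ⟨t, by omega, by omega⟩
  | a w ih =>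
    rw [normalFrom_mul, normalFrom_of, FreeMonoid.length_mul, FreeMonoid.length_of]
    generalize normalFrom d (0, 0) w = s at ih ⊢
    obtain ⟨i, j⟩ := s
    simp only at ih
    simp only [normalStep]
    rcases ih with ⟨rfl, h⟩ | ⟨t, h, h'⟩
    · left
      simp [h]
    · right
      have hj : j ≠ 0 := by omega
      refine ⟨t + 1, ?_, ?_⟩ <;> simp only [hj, if_false, zero_ne_one] <;> linarith

theorem length_le_normalFrom (d : ℕ) (w : FreeMonoid (Fin 2)) :
    w.length ≤ (normalFrom d (0, 0) w).1 + (normalFrom d (0, 0) w).2 := by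
  rcases exists_length_normalFrom d w with ⟨_, h⟩ | ⟨t, _, h⟩ <;> omega

theorem isUnit_bnMk_iff {d : ℕ} {w : FreeMonoid (Fin 2)} :
    IsUnit (bnMk (d + 2) w) ↔ w = 1 := by
  refine ⟨fun h => ?_, fun h => by rw [h, map_one]; exact isUnit_one⟩
  obtain ⟨y, hy⟩ := h.exists_right_inv
  obtain ⟨v, rfl⟩ := bnMk_surjective _ y
  rw [← map_mul, ← map_one (bnMk (d + 2)), bnMk_eq_iff, normalFrom_one] at hy
  have := length_le_normalFrom d (w * v)
  rw [hy, FreeMonoid.length_mul] at this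
  exact FreeMonoid.length_eq_zero.1 (by simp only at this; omega)

theorem isMonAtom_bnMk_of (d : ℕ) (x : Fin 2) :
    IsMonAtom (bnMk (d + 2) (FreeMonoid.of x)) := by
  refine ⟨fun h => FreeMonoid.of_ne_one x (isUnit_bnMk_iff.1 h), fun y z h => ?_⟩
  obtain ⟨v, rfl⟩ := bnMk_surjective _ y
  obtain ⟨w, rfl⟩ := bnMk_surjective _ z
  rw [← map_mul, bnMk_eq_iff, normalFrom_of] at h
  have hl := length_le_normalFrom d (v * w)
  have hx : (normalStep d (0, 0) x).1 + (normalStep d (0, 0) x).2 = 1 := by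
    fin_cases x <;> simp [normalStep]
  rw [← h, hx, FreeMonoid.length_mul] at hl
  rw [isUnit_bnMk_iff, isUnit_bnMk_iff, ← FreeMonoid.length_eq_zero, ← FreeMonoid.length_eq_zero]
  omega

theorem exists_of_isMonAtom {d : ℕ} {u : Bn (d + 2)} (hu : IsMonAtom u) :
    ∃ x, bnMk (d + 2) (FreeMonoid.of x) = u := by
  obtain ⟨w, rfl⟩ := bnMk_surjective _ u
  induction w using FreeMonoid.casesOn with
  | one => exact absurd (isUnit_bnMk_iff.2 rfl) hu.1
  | of_mul x v =>
    refine ⟨x, ?_⟩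
    rcases hu.2 _ _ (map_mul _ _ _) with h | h
    · exact absurd h (isMonAtom_bnMk_of d x).1
    · rw [isUnit_bnMk_iff.1 h, mul_one]

theorem setOfLengths_bnMk (d : ℕ) (w : FreeMonoid (Fin 2)) :
    setOfLengths (bnMk (d + 2) w) =
      {k | ∃ v : FreeMonoid (Fin 2), v.length = k ∧
        normalFrom d (0, 0) v = normalFrom d (0, 0) w} := by
  unfold setOfLengths
  ext k
  simp only [← bnMk_eq_iff]
  split_ifs with h
  · rw [h, Set.mem_singleton_iff]
    constructor
    · rintro rfl
      exact ⟨1, rfl, map_one _⟩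
    · rintro ⟨v, rfl, hv⟩
      rw [isUnit_bnMk_iff.1 (hv ▸ isUnit_one : IsUnit (bnMk (d + 2) v))]
      rfl
  · constructor
    · rintro ⟨l, rfl, hl, hw⟩
      rw [← hw]
      clear hw
      induction l with
      | nil => exact ⟨1, rfl, map_one _⟩
      | cons u l ih =>
        obtain ⟨v, hv, hv'⟩ := ih fun y hy => hl y (List.mem_cons_of_mem _ hy)
        obtain ⟨x, rfl⟩ := exists_of_isMonAtom (hl u List.mem_cons_self)
        refine ⟨FreeMonoid.of x * v, ?_, ?_⟩
        · rw [FreeMonoid.length_mul, FreeMonoid.length_of, hv, List.length_cons, add_comm]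
        · rw [map_mul, hv', List.prod_cons]
    · rintro ⟨v, rfl, hv⟩
      refine ⟨v.toList.map fun x => bnMk (d + 2) (FreeMonoid.of x), List.length_map _, ?_, ?_⟩
      · intro u hu
        obtain ⟨x, -, rfl⟩ := List.mem_map.1 hu
        exact isMonAtom_bnMk_of d x
      · rw [← hv, ← FreeMonoid.lift_apply]
        exact DFunLike.congr_fun (FreeMonoid.lift_restrict (bnMk (d + 2))) v

/-- The arithmetic progression `m, m + d, …, m + T * d`. -/
def lengthProgression (d m T : ℕ) : Set ℕ := {k | ∃ t ≤ T, k = m + d * t}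

theorem setOfLengths_bnMk_of_eq_zero {d i : ℕ} {w : FreeMonoid (Fin 2)}
    (h : normalFrom d (0, 0) w = (i, 0)) :
    setOfLengths (bnMk (d + 2) w) = lengthProgression d i 0 := by
  rw [setOfLengths_bnMk, h]
  ext k
  constructor
  · rintro ⟨v, rfl, hv⟩
    refine ⟨0, le_rfl, ?_⟩
    rcases exists_length_normalFrom d v with ⟨_, h⟩ | ⟨t, h, h'⟩
    · simpa [hv] using h.symm
    · simp [hv] at h
  · rintro ⟨t, ht, rfl⟩
    obtain rfl : t = 0 := by omega
    exact ⟨FreeMonoid.of 0 ^ i, by simp [length_freeMonoid_of_pow], by simp [normalFrom_a_pow]⟩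

theorem setOfLengths_bnMk_of_eq_succ {d i j : ℕ} {w : FreeMonoid (Fin 2)}
    (h : normalFrom d (0, 0) w = (i, j + 1)) :
    setOfLengths (bnMk (d + 2) w) =
      lengthProgression d (i + j + 1 - d * (j / (d + 1))) (j / (d + 1)) := by
  rw [setOfLengths_bnMk, h]
  have hT : j / (d + 1) * (d + 1) ≤ j := Nat.div_mul_le_self j (d + 1)
  ext k
  constructor
  · rintro ⟨v, rfl, hv⟩
    rcases exists_length_normalFrom d v with ⟨h, _⟩ | ⟨t, h, h'⟩
    · simp [hv] at h
    · simp only [hv] at h h'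
      have ht : t ≤ j / (d + 1) := (Nat.le_div_iff_mul_le d.succ_pos).2 (Nat.le_of_succ_le_succ h)
      obtain ⟨s, hs⟩ := Nat.exists_eq_add_of_le ht
      refine ⟨s, by omega, ?_⟩
      rw [hs] at hT ⊢
      have : d * (t + s) ≤ i + j + 1 := by nlinarith
      zify [this]
      zify at h'
      linarith
  · rintro ⟨s, hs, rfl⟩
    obtain ⟨t, ht⟩ := Nat.exists_eq_add_of_le hs
    rw [ht] at hT ⊢
    have h₁ : (d + 1) * t ≤ j := by nlinarith
    have h₂ : d * (s + t) ≤ i + j + 1 := by nlinarith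
    obtain ⟨r, rfl⟩ := Nat.exists_eq_add_of_le h₁
    refine ⟨FreeMonoid.of 0 ^ i * FreeMonoid.of 1 ^ (r + 1) * FreeMonoid.of 0 ^ t, ?_, ?_⟩
    · simp only [FreeMonoid.length_mul, length_freeMonoid_of_pow]
      zify [h₂]
      ring
    · rw [normalFrom_mul, normalFrom_mul, normalFrom_a_pow, normalFrom_b_pow, ← add_assoc,
        normalFrom_a_pow_succ]
      ext <;> (simp; try ring)

/-- The sets of lengths of `B_{d+2}` are `{0}` and the progressions with difference `d` whose number
of elements is at most the minimum. -/
theorem mem_LSystem_iff {d : ℕ} {L : Set ℕ} :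
    L ∈ LSystem (Bn (d + 2)) ↔
      ∃ m T, (T + 1 ≤ m ∨ m = 0 ∧ T = 0) ∧ L = lengthProgression d m T := by
  constructor
  · rintro ⟨x, rfl⟩
    obtain ⟨w, rfl⟩ := bnMk_surjective _ x
    rcases h : normalFrom d (0, 0) w with ⟨i, _ | j⟩
    · exact ⟨i, 0, by omega, setOfLengths_bnMk_of_eq_zero h⟩
    · refine ⟨_, _, Or.inl ?_, setOfLengths_bnMk_of_eq_succ h⟩
      have hT : j / (d + 1) * (d + 1) ≤ j := Nat.div_mul_le_self j (d + 1)
      refine Nat.le_sub_of_add_le ?_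
      nlinarith
  · rintro ⟨m, T, hm | ⟨rfl, rfl⟩, rfl⟩
    · obtain ⟨i, rfl⟩ := Nat.exists_eq_add_of_le hm
      have hw : normalFrom d (0, 0) (FreeMonoid.of 0 ^ i * FreeMonoid.of 1 ^ (T * (d + 1) + 1)) =
          (i, T * (d + 1) + 1) := by
        rw [normalFrom_mul, normalFrom_a_pow, normalFrom_b_pow]
        simp
      refine ⟨_, (setOfLengths_bnMk_of_eq_succ hw).trans ?_⟩
      rw [Nat.mul_div_cancel _ d.succ_pos]
      congr 1
      refine Nat.sub_eq_of_eq_add ?_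
      ring
    · exact ⟨bnMk (d + 2) 1, setOfLengths_bnMk_of_eq_zero rfl⟩

theorem lengthProgression_add (d m T m' T' : ℕ) :
    lengthProgression d m T + lengthProgression d m' T' =
      lengthProgression d (m + m') (T + T') := by
  ext k
  rw [Set.mem_add]
  constructor
  · rintro ⟨_, ⟨t, ht, rfl⟩, _, ⟨t', ht', rfl⟩, rfl⟩
    exact ⟨t + t', by omega, by ring⟩
  · rintro ⟨t, ht, rfl⟩
    refine ⟨_, ⟨min t T, min_le_right _ _, rfl⟩, _, ⟨t - min t T, by omega, rfl⟩, ?_⟩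
    have : t = min t T + (t - min t T) := by omega
    conv_rhs => rw [this]
    ring

theorem lengthProgression_zero (d : ℕ) : lengthProgression d 0 0 = 0 := by
  ext k
  simp [lengthProgression]

theorem sInf_lengthProgression (d m T : ℕ) : sInf (lengthProgression d m T) = m := by
  refine IsLeast.csInf_eq ⟨⟨0, T.zero_le, by simp⟩, ?_⟩
  rintro _ ⟨t, _, rfl⟩
  omega

theorem sInf_add_of_mem_LSystem {d : ℕ} {L U : Set ℕ} (hL : L ∈ LSystem (Bn (d + 2)))
    (hU : U ∈ LSystem (Bn (d + 2))) : sInf (L + U) = sInf L + sInf U := by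
  obtain ⟨m, T, -, rfl⟩ := mem_LSystem_iff.1 hL
  obtain ⟨m', T', -, rfl⟩ := mem_LSystem_iff.1 hU
  simp only [lengthProgression_add, sInf_lengthProgression]

theorem eq_zero_of_sInf_eq_zero {d : ℕ} {L : Set ℕ} (hL : L ∈ LSystem (Bn (d + 2)))
    (h : sInf L = 0) : L = 0 := by
  obtain ⟨m, T, hm, rfl⟩ := mem_LSystem_iff.1 hL
  rw [sInf_lengthProgression] at h
  obtain ⟨rfl, rfl⟩ : m = 0 ∧ T = 0 := by omega
  exact lengthProgression_zero d

theorem exists_list_LSysAtom_sum_eq {d : ℕ} {L : Set ℕ} (hL : L ∈ LSystem (Bn (d + 2)))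
    (h₀ : L ≠ 0) : ∃ l : List (Set ℕ), (∀ X ∈ l, LSysAtom (d + 2) X) ∧ l.sum = L := by
  induction hm : sInf L using Nat.strong_induction_on generalizing L with
  | _ m ih =>
    subst hm
    by_cases h : LSysAtom (d + 2) L
    · exact ⟨[L], by simpa using h, by simp⟩
    · obtain ⟨Y, Z, hY, hZ, rfl, hY₀, hZ₀⟩ : ∃ Y Z : Set ℕ, Y ∈ LSystem (Bn (d + 2)) ∧
          Z ∈ LSystem (Bn (d + 2)) ∧ L = Y + Z ∧ Y ≠ 0 ∧ Z ≠ 0 := by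
        by_contra! h'
        exact h ⟨hL, h₀, fun Y Z hY hZ e => or_iff_not_imp_left.2 (h' Y Z hY hZ e)⟩
      have hs := sInf_add_of_mem_LSystem hY hZ
      have hY₁ := mt (eq_zero_of_sInf_eq_zero hY) hY₀
      have hZ₁ := mt (eq_zero_of_sInf_eq_zero hZ) hZ₀
      obtain ⟨l, hl, rfl⟩ := ih _ (by omega) hY hY₀ rfl
      obtain ⟨l', hl', rfl⟩ := ih _ (by omega) hZ hZ₀ rfl
      exact ⟨l ++ l', fun X hX => (List.mem_append.1 hX).elim (hl X) (hl' X), List.sum_append⟩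

/-- For `n ≥ 3`, the system of sets of lengths `𝓛(B_n)` is
closed under set addition; consequently, with set addition as operation (which is
commutative, with zero element `{0}`), `𝓛(B_n)` is a reduced atomic
unit-cancellative commutative monoid. -/
theorem statement9 (n : ℕ) (hn : 3 ≤ n) :
    -- closed under set addition
    (∀ L₁ ∈ LSystem (Bn n), ∀ L₂ ∈ LSystem (Bn n), L₁ + L₂ ∈ LSystem (Bn n)) ∧
    -- the zero element `{0}` belongs to `𝓛(B_n)` and is neutral
    (0 : Set ℕ) ∈ LSystem (Bn n) ∧
    (∀ L ∈ LSystem (Bn n), L + 0 = L ∧ 0 + L = L) ∧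
    -- the operation is commutative
    (∀ L₁ ∈ LSystem (Bn n), ∀ L₂ ∈ LSystem (Bn n), L₁ + L₂ = L₂ + L₁) ∧
    -- reduced: the only invertible element is `0`
    (∀ L₁ ∈ LSystem (Bn n), ∀ L₂ ∈ LSystem (Bn n), L₁ + L₂ = 0 → L₁ = 0) ∧
    -- unit-cancellative
    (∀ L ∈ LSystem (Bn n), ∀ U ∈ LSystem (Bn n), L + U = L → U = 0) ∧
    -- atomic
    (∀ L ∈ LSystem (Bn n), L ≠ 0 →
      ∃ l : List (Set ℕ), (∀ X ∈ l, LSysAtom n X) ∧ l.sum = L) := by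
  obtain ⟨d, rfl⟩ : ∃ d, n = d + 2 := ⟨n - 2, by omega⟩
  refine ⟨?_, mem_LSystem_iff.2 ⟨0, 0, Or.inr ⟨rfl, rfl⟩, (lengthProgression_zero d).symm⟩,
    fun L _ => ⟨add_zero L, zero_add L⟩, fun L₁ _ L₂ _ => add_comm L₁ L₂, ?_, ?_,
    fun L hL => exists_list_LSysAtom_sum_eq hL⟩
  · intro L₁ h₁ L₂ h₂
    obtain ⟨m, T, hm, rfl⟩ := mem_LSystem_iff.1 h₁
    obtain ⟨m', T', hm', rfl⟩ := mem_LSystem_iff.1 h₂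
    exact mem_LSystem_iff.2 ⟨m + m', T + T', by omega, lengthProgression_add d m T m' T'⟩
  · intro L₁ h₁ L₂ h₂ h
    have hs := sInf_add_of_mem_LSystem h₁ h₂
    rw [h, ← lengthProgression_zero d, sInf_lengthProgression] at hs
    exact eq_zero_of_sInf_eq_zero h₁ (by omega)
  · intro L hL U hU h
    have hs := sInf_add_of_mem_LSystem hL hU
    rw [h] at hs
    exact eq_zero_of_sInf_eq_zero hU (by omega)
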